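/- Fix integers d ≥ 0, e with −1 ≤ e ≤ d, and i ≥ 0. Then there exist integers c_{I,k}, indexed by the finitely many pairs (I,k) with I = (i_1,…,i_n), −1 ≤ i_1 < ⋯ < i_n ≤ d and 1 ≤ k ≤ n, i_k ≥ e, such that for every d-dimensional convex polytope P and every face F of P of dimension e, g_i(P,F) = Σ_{(I,k)} c_{I,k}·f_{I,k}(P,F). -/

import Mathlib

open Polynomial
open scoped Classical

noncomputable section

/-- `P ⊆ ℝ^d` is a (convex) polytope: the convex hull of a finite set of points. -/
def IsPolytope {d : ℕ} (P : Set (Fin d → ℝ)) : Prop :=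
  ∃ S : Finset (Fin d → ℝ), P = convexHull ℝ (S : Set (Fin d → ℝ))

/-- `F` is a face of `P`: the empty set, `P` itself, or the intersection of `P`
with a supporting hyperplane. -/
def IsFace {d : ℕ} (P F : Set (Fin d → ℝ)) : Prop :=
  F = ∅ ∨ F = P ∨ ∃ (f : (Fin d → ℝ) →ₗ[ℝ] ℝ) (c : ℝ),
    (∀ x ∈ P, f x ≤ c) ∧ F = {x ∈ P | f x = c}

/-- Affine dimension of a subset of `ℝ^d`, with `pdim ∅ = -1`. -/
def pdim {d : ℕ} (P : Set (Fin d → ℝ)) : ℤ :=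
  if P = ∅ then -1 else (Module.finrank ℝ (affineSpan ℝ P).direction : ℤ)

/-- The pair of functions `g`, `h` satisfies the defining recursion of the
`g`- and `h`-polynomials of polytopes. -/
def IsGH {d : ℕ} (g h : Set (Fin d → ℝ) → Polynomial ℤ) : Prop :=
  g ∅ = 1 ∧
  (∀ P : Set (Fin d → ℝ), IsPolytope P →
      h P = ∑ᶠ F ∈ {F : Set (Fin d → ℝ) | IsFace P F ∧ F ≠ P},
        (X - 1 : Polynomial ℤ) ^ (pdim P - pdim F - 1).toNat * g F) ∧
  (∀ P : Set (Fin d → ℝ), IsPolytope P → P ≠ ∅ →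
      (g P).coeff 0 = (h P).coeff 0 ∧
      (∀ i : ℕ, 0 < i → 2 * (i : ℤ) ≤ pdim P →
        (g P).coeff i = (h P).coeff i - (h P).coeff (i - 1)) ∧
      (∀ i : ℕ, 0 < i → ¬(2 * (i : ℤ) ≤ pdim P) → (g P).coeff i = 0))

/-- `Q` is (a combinatorial model of) the quotient polytope `P/E`, with `ψ` an
explicit isomorphism from the interval `[E, P]` in the face poset of `P` to the
face poset of `Q`. -/
def IsQuotientPair {d : ℕ} (P E Q : Set (Fin d → ℝ))
    (ψ : Set (Fin d → ℝ) → Set (Fin d → ℝ)) : Prop :=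
  IsPolytope Q ∧
  Set.BijOn ψ {G : Set (Fin d → ℝ) | IsFace P G ∧ E ⊆ G} {G : Set (Fin d → ℝ) | IsFace Q G} ∧
  ∀ G₁ ∈ {G : Set (Fin d → ℝ) | IsFace P G ∧ E ⊆ G},
    ∀ G₂ ∈ {G : Set (Fin d → ℝ) | IsFace P G ∧ E ⊆ G}, (G₁ ⊆ G₂ ↔ ψ G₁ ⊆ ψ G₂)

/-- The family `gr` of relative `g`-polynomials satisfies the defining relation
`∑_{F ≤ E ≤ P} g(E,F) g(P/E) = g(P)` (where `g(P/P) = 1`, the quotient by `P`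
itself being the empty polytope). -/
def IsRelG {d : ℕ} (g : Set (Fin d → ℝ) → Polynomial ℤ)
    (gr : Set (Fin d → ℝ) → Set (Fin d → ℝ) → Polynomial ℤ) : Prop :=
  ∀ (P F : Set (Fin d → ℝ)) (Q : Set (Fin d → ℝ) → Set (Fin d → ℝ))
    (ψ : Set (Fin d → ℝ) → Set (Fin d → ℝ) → Set (Fin d → ℝ)),
    IsPolytope P → IsFace P F →
    (∀ E, IsFace P E → F ⊆ E → IsQuotientPair P E (Q E) (ψ E)) →
    (∑ᶠ E ∈ {E : Set (Fin d → ℝ) | IsFace P E ∧ F ⊆ E}, gr E F * g (Q E)) = g P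

/-- A rational polytope: the convex hull of finitely many points with rational
coordinates. -/
def IsRationalPolytope {d : ℕ} (P : Set (Fin d → ℝ)) : Prop :=
  ∃ S : Finset (Fin d → ℝ), (∀ v ∈ S, ∀ i : Fin d, ∃ q : ℚ, v i = (q : ℝ)) ∧
    P = convexHull ℝ (S : Set (Fin d → ℝ))

/-- The relative flag number `f_{I,k}(P,F)`: the number of chains
`F₁ < F₂ < ⋯ < Fₙ` of faces of `P` with `dim F_j = I j` for all `j` and `F ≤ F_k`. -/
def relFlag {d : ℕ} (n : ℕ) (I : Fin n → ℤ) (k : Fin n)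
    (P F : Set (Fin d → ℝ)) : ℕ :=
  Set.ncard {c : Fin n → Set (Fin d → ℝ) |
    StrictMono c ∧ (∀ j, IsFace P (c j) ∧ pdim (c j) = I j) ∧ F ⊆ c k}

section Geometry
variable {d : ℕ}

lemma face_hull (S : Set (Fin d → ℝ)) (f : (Fin d → ℝ) →ₗ[ℝ] ℝ) (c : ℝ)
    (h : ∀ w ∈ S, f w ≤ c) :
    {x ∈ convexHull ℝ S | f x = c} = convexHull ℝ {w ∈ S | f w = c} := by
  apply Set.Subset.antisymm
  · have hle : ∀ x ∈ convexHull ℝ {w ∈ S | f w = c}, f x = c := by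
      have hc : Convex ℝ {x | f x = c} := convex_hyperplane f.isLinear c
      exact fun x hx => convexHull_min (s := {w ∈ S | f w = c}) (fun w hw => hw.2) hc hx
    have hconv : Convex ℝ {x | f x < c ∨ x ∈ convexHull ℝ {w ∈ S | f w = c}} := by
      rw [convex_iff_forall_pos]
      intro x hx y hy a b ha hb hab
      have hc : c = a * c + b * c := by rw [← add_mul, hab, one_mul]
      simp only [Set.mem_ofPred_eq] at hx hy ⊢
      rcases hx with hx | hx
      · left
        have hy' : f y ≤ c := by
          rcases hy with hy | hy
          · exact hy.le
          · exact (hle y hy).le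
        rw [map_add, map_smul, map_smul, smul_eq_mul, smul_eq_mul, hc]
        nlinarith [mul_lt_mul_of_pos_left hx ha, mul_le_mul_of_nonneg_left hy' hb.le]
      · rcases hy with hy | hy
        · left
          have hx' := (hle x hx).le
          rw [map_add, map_smul, map_smul, smul_eq_mul, smul_eq_mul, hc]
          nlinarith [mul_lt_mul_of_pos_left hy hb, mul_le_mul_of_nonneg_left hx' ha.le]
        · right
          exact (convex_convexHull ℝ _) hx hy ha.le hb.le hab
    rintro x ⟨hx, hfx⟩
    have := convexHull_min (s := S) (fun w hw => ?_) hconv hx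
    · rcases this with h1 | h1
      · exact absurd hfx h1.ne
      · exact h1
    · rcases lt_or_eq_of_le (h w hw) with h1 | h1
      · exact Or.inl h1
      · exact Or.inr (subset_convexHull ℝ _ ⟨hw, h1⟩)
  · intro x hx
    refine ⟨convexHull_mono (fun w hw => hw.1) hx, ?_⟩
    have hc : Convex ℝ {x | f x = c} := convex_hyperplane f.isLinear c
    exact convexHull_min (s := {w ∈ S | f w = c}) (fun w hw => hw.2) hc hx

lemma hull_le (S : Set (Fin d → ℝ)) (f : (Fin d → ℝ) →ₗ[ℝ] ℝ) (c : ℝ)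
    (h : ∀ w ∈ S, f w ≤ c) : ∀ x ∈ convexHull ℝ S, f x ≤ c := by
  have hc : Convex ℝ {x | f x ≤ c} := convex_halfSpace_le f.isLinear c
  exact fun x hx => convexHull_min (s := S) (fun w hw => h w hw) hc hx

lemma IsFace.functional {P F : Set (Fin d → ℝ)} (h : IsFace P F) (hne : F ≠ ∅) :
    ∃ (f : (Fin d → ℝ) →ₗ[ℝ] ℝ) (c : ℝ), (∀ x ∈ P, f x ≤ c) ∧ F = {x ∈ P | f x = c} := by
  rcases h with h | h | h
  · exact absurd h hne
  · exact ⟨0, 0, by simp, by simp [h]⟩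
  · exact h

lemma IsFace.subset {P F : Set (Fin d → ℝ)} (h : IsFace P F) : F ⊆ P := by
  rcases h with h | h | ⟨f, c, _, h⟩
  · simp [h]
  · exact h.le
  · rw [h]; exact fun x hx => hx.1

lemma IsFace.refl (P : Set (Fin d → ℝ)) : IsFace P P := Or.inr (Or.inl rfl)
lemma IsFace.empty (P : Set (Fin d → ℝ)) : IsFace P ∅ := Or.inl rfl

lemma IsFace.restrict {P F G : Set (Fin d → ℝ)} (hG : IsFace P G) (hF : F ⊆ P) (h : G ⊆ F) :
    IsFace F G := by
  by_cases hne : G = ∅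
  · exact Or.inl hne
  obtain ⟨f, c, hf, rfl⟩ := hG.functional hne
  refine Or.inr (Or.inr ⟨f, c, fun x hx => hf x (hF hx), ?_⟩)
  ext x
  exact ⟨fun hx => ⟨h hx, hx.2⟩, fun hx => ⟨hF hx.1, hx.2⟩⟩

lemma IsFace.eq_hull {S : Set (Fin d → ℝ)} {F : Set (Fin d → ℝ)}
    (h : IsFace (convexHull ℝ S) F) : F = convexHull ℝ {w ∈ S | w ∈ F} := by
  by_cases hne : F = ∅
  · simp [hne]
  obtain ⟨f, c, hf, hF⟩ := h.functional hne
  have := face_hull S f c (fun w hw => hf w (subset_convexHull ℝ _ hw))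
  rw [← hF] at this
  rw [this]
  congr 1
  ext w
  constructor
  · rintro ⟨hw, h1⟩
    exact ⟨hw, subset_convexHull ℝ _ ⟨hw, h1⟩⟩
  · rintro ⟨hw, h1⟩
    rw [← this, hF] at h1
    exact ⟨hw, h1.2⟩

lemma IsFace.isPolytope {P F : Set (Fin d → ℝ)} (hP : IsPolytope P) (h : IsFace P F) :
    IsPolytope F := by
  obtain ⟨S, rfl⟩ := hP
  refine ⟨S.filter (· ∈ F), ?_⟩
  conv_lhs => rw [h.eq_hull]
  simp

lemma finite_faces {P : Set (Fin d → ℝ)} (hP : IsPolytope P) : {G | IsFace P G}.Finite := by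
  obtain ⟨S, rfl⟩ := hP
  refine Set.Finite.subset (Set.Finite.image (convexHull ℝ) (S.finite_toSet.finite_subsets)) ?_
  intro G hG
  exact ⟨{w ∈ (S : Set (Fin d → ℝ)) | w ∈ G}, fun w hw => hw.1, (IsFace.eq_hull hG).symm⟩

lemma IsFace.trans {P F G : Set (Fin d → ℝ)} (hP : IsPolytope P) (hF : IsFace P F)
    (hG : IsFace F G) : IsFace P G := by
  by_cases hne : G = ∅
  · exact Or.inl hne
  have hFne : F ≠ ∅ := by
    rintro rfl
    exact hne (Set.subset_empty_iff.1 hG.subset)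
  obtain ⟨S, rfl⟩ := hP
  obtain ⟨f, c, hf, hFeq⟩ := hF.functional hFne
  obtain ⟨k, b, hk, hGeq⟩ := hG.functional hne
  obtain ⟨N, hN⟩ : ∃ N : ℝ, ∀ w ∈ S, f w < c → k w - b < N * (c - f w) := by
    obtain ⟨M, hM⟩ := (S.image (fun w => (k w - b) / (c - f w))).finite_toSet.bddAbove
    refine ⟨M + 1, fun w hw hlt => ?_⟩
    have := hM (Finset.mem_coe.2 (Finset.mem_image_of_mem (fun w => (k w - b) / (c - f w)) hw))
    have hpos : 0 < c - f w := by linarith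
    rw [div_le_iff₀ hpos] at this
    nlinarith
  have hS : ∀ w ∈ S, w ∈ convexHull ℝ (S : Set (Fin d → ℝ)) := fun w hw => subset_convexHull ℝ _ hw
  have key : ∀ w ∈ S, (w ∈ G ∧ (N • f + k) w = N * c + b) ∨
      (w ∉ G ∧ (N • f + k) w < N * c + b) := by
    intro w hw
    simp only [LinearMap.add_apply, LinearMap.smul_apply, smul_eq_mul]
    by_cases hwF : w ∈ F
    · have h1 : f w = c := by rw [hFeq] at hwF; exact hwF.2
      by_cases hwG : w ∈ G
      · left
        have h2 : k w = b := by rw [hGeq] at hwG; exact hwG.2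
        exact ⟨hwG, by rw [h1, h2]⟩
      · right
        refine ⟨hwG, ?_⟩
        have h2 : k w ≠ b := fun h2 => hwG (by rw [hGeq]; exact ⟨hwF, h2⟩)
        have := lt_of_le_of_ne (hk w hwF) h2
        rw [h1]; linarith
    · right
      refine ⟨fun h => hwF (hG.subset h), ?_⟩
      have h1 : f w ≠ c := fun h2 => hwF (by rw [hFeq]; exact ⟨hS w hw, h2⟩)
      have := hN w hw (lt_of_le_of_ne (hf w (hS w hw)) h1)
      linarith
  have hle : ∀ w ∈ (S : Set (Fin d → ℝ)), (N • f + k) w ≤ N * c + b := by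
    intro w hw
    rcases key w hw with h | h
    · exact h.2.le
    · exact h.2.le
  refine Or.inr (Or.inr ⟨N • f + k, N * c + b, hull_le _ _ _ hle, ?_⟩)
  rw [face_hull _ _ _ hle]
  have h1 : F = convexHull ℝ {w ∈ (S : Set (Fin d → ℝ)) | w ∈ F} := hF.eq_hull
  have h2 : G = convexHull ℝ {w ∈ {w ∈ (S : Set (Fin d → ℝ)) | w ∈ F} | w ∈ G} := by
    rw [h1] at hG
    exact hG.eq_hull
  rw [h2]
  congr 1
  ext w
  constructor
  · rintro ⟨⟨hw, _⟩, hwG⟩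
    rcases key w hw with h | h
    · exact ⟨hw, h.2⟩
    · exact absurd hwG h.1
  · rintro ⟨hw, h3⟩
    rcases key w hw with h | h
    · exact ⟨⟨hw, hG.subset h.1⟩, h.1⟩
    · exact absurd h3 h.2.ne

lemma pdim_empty : pdim (∅ : Set (Fin d → ℝ)) = -1 := by simp [pdim]

lemma pdim_of_ne {P : Set (Fin d → ℝ)} (h : P ≠ ∅) :
    pdim P = (Module.finrank ℝ (vectorSpan ℝ P) : ℤ) := by
  rw [pdim, if_neg h, direction_affineSpan]

lemma pdim_nonneg {P : Set (Fin d → ℝ)} (h : P ≠ ∅) : 0 ≤ pdim P := by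
  rw [pdim_of_ne h]; positivity

lemma pdim_ge (P : Set (Fin d → ℝ)) : -1 ≤ pdim P := by
  by_cases h : P = ∅
  · rw [h, pdim_empty]
  · have := pdim_nonneg h; omega

lemma pdim_eq_neg_one {P : Set (Fin d → ℝ)} : pdim P = -1 ↔ P = ∅ := by
  constructor
  · intro h
    by_contra hne
    have := pdim_nonneg hne; omega
  · rintro rfl; exact pdim_empty

lemma pdim_mono {P F : Set (Fin d → ℝ)} (h : F ⊆ P) : pdim F ≤ pdim P := by
  by_cases hF : F = ∅
  · rw [hF, pdim_empty]; exact pdim_ge P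
  have hP : P ≠ ∅ := by
    rintro rfl; exact hF (Set.subset_empty_iff.1 h)
  rw [pdim_of_ne hF, pdim_of_ne hP]
  exact_mod_cast Submodule.finrank_mono (vectorSpan_mono ℝ h)

lemma pdim_lt {P F : Set (Fin d → ℝ)} (hF : IsFace P F) (hne : F ≠ P) : pdim F < pdim P := by
  by_cases h0 : F = ∅
  · subst h0
    rw [pdim_empty]
    have := pdim_nonneg (Ne.symm hne); omega
  obtain ⟨f, c, hf, hFeq⟩ := hF.functional h0
  have hP : P ≠ ∅ := by
    rintro rfl; exact h0 (Set.subset_empty_iff.1 hF.subset)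
  rw [pdim_of_ne h0, pdim_of_ne hP]
  obtain ⟨x, hx, hxF⟩ : ∃ x ∈ P, x ∉ F := by
    by_contra! hcon
    exact hne (Set.Subset.antisymm hF.subset hcon)
  obtain ⟨p, hp⟩ := Set.nonempty_iff_ne_empty.2 h0
  have hker : vectorSpan ℝ F ≤ LinearMap.ker f := by
    rw [vectorSpan_def, Submodule.span_le]
    rintro _ ⟨a, ha, b, hb, rfl⟩
    rw [hFeq] at ha hb
    simp [ha.2, hb.2]
  have : vectorSpan ℝ F < vectorSpan ℝ P := by
    refine lt_of_le_of_ne (vectorSpan_mono ℝ hF.subset) fun heq => ?_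
    have h1 : x -ᵥ p ∈ vectorSpan ℝ F := by
      rw [heq]; exact vsub_mem_vectorSpan ℝ hx (hF.subset hp)
    have h2 := hker h1
    rw [hFeq] at hp
    rw [LinearMap.mem_ker, vsub_eq_sub, map_sub, hp.2] at h2
    exact hxF (by rw [hFeq]; exact ⟨hx, by linarith⟩)
  exact_mod_cast Submodule.finrank_lt_finrank_of_lt this

end Geometry
section Quotient
variable {d : ℕ}

/-- A quotient pair for which the isomorphism shifts dimensions correctly. -/
def DQ (P E Q : Set (Fin d → ℝ)) (ψ : Set (Fin d → ℝ) → Set (Fin d → ℝ)) : Prop :=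
  IsQuotientPair P E Q ψ ∧
    ∀ G, IsFace P G → E ⊆ G → pdim (ψ G) = pdim G - pdim E - 1

lemma pdim_hull (A : Set (Fin d → ℝ)) : pdim (convexHull ℝ A) = pdim A := by
  by_cases h : A = ∅
  · simp [h]
  · have h' : convexHull ℝ A ≠ ∅ := by simpa using h
    rw [pdim, pdim, if_neg h, if_neg h', affineSpan_convexHull]

lemma finrank_span_of_level (A : Set (Fin d → ℝ)) (l : (Fin d → ℝ) →ₗ[ℝ] ℝ)
    (h : ∀ a ∈ A, l a = 1) : (Module.finrank ℝ (Submodule.span ℝ A) : ℤ) = pdim A + 1 := by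
  by_cases h0 : A = ∅
  · subst h0; simp [pdim_empty]
  obtain ⟨a, ha⟩ := Set.nonempty_iff_ne_empty.2 h0
  rw [pdim_of_ne h0]
  have hker : vectorSpan ℝ A ≤ LinearMap.ker l := by
    rw [vectorSpan_def, Submodule.span_le]
    rintro _ ⟨x, hx, b, hb, rfl⟩
    simp [h x hx, h b hb]
  have ha0 : a ≠ 0 := by
    rintro rfl
    have := h 0 ha
    simp at this
  have hsup : Submodule.span ℝ A = vectorSpan ℝ A ⊔ Submodule.span ℝ {a} := by
    apply le_antisymm
    · rw [Submodule.span_le]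
      intro x hx
      have : x = (x -ᵥ a) + a := by simp
      rw [this]
      exact Submodule.add_mem_sup (vsub_mem_vectorSpan ℝ hx ha) (Submodule.mem_span_singleton_self a)
    · refine sup_le ?_ ?_
      · rw [vectorSpan_def, Submodule.span_le]
        rintro _ ⟨x, hx, b, hb, rfl⟩
        exact Submodule.sub_mem _ (Submodule.subset_span hx) (Submodule.subset_span hb)
      · rw [Submodule.span_le]
        rintro _ rfl
        exact Submodule.subset_span ha
  have hdisj : vectorSpan ℝ A ⊓ Submodule.span ℝ {a} = ⊥ := by
    rw [eq_bot_iff]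
    rintro x ⟨hx1, hx2⟩
    obtain ⟨t, rfl⟩ := Submodule.mem_span_singleton.1 hx2
    have := hker hx1
    rw [LinearMap.mem_ker, map_smul, h a ha] at this
    have ht : t = 0 := by simpa using this
    simp [ht]
  have := Submodule.finrank_sup_add_finrank_inf_eq (vectorSpan ℝ A) (Submodule.span ℝ {a})
  rw [hdisj, ← hsup, finrank_bot, finrank_span_singleton ha0] at this
  exact_mod_cast this

lemma exists_proj (W : Submodule ℝ (Fin d → ℝ)) :
    ∃ π : (Fin d → ℝ) →ₗ[ℝ] (Fin d → ℝ), LinearMap.ker π = W ∧ ∀ x, π x - x ∈ W := by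
  obtain ⟨W', hW⟩ := W.exists_isCompl
  refine ⟨W'.projection W hW.symm, Submodule.ker_projection hW.symm, fun x => ?_⟩
  rw [Submodule.projection_eq_self_sub_projection hW x]
  have : x - W.projection W' hW x - x = -(W.projection W' hW x) := by abel
  rw [this]
  refine Submodule.neg_mem _ ?_
  have h := Submodule.range_projection hW
  exact h.le (LinearMap.mem_range_self _ x)

lemma exists_DQ {P E : Set (Fin d → ℝ)} (hP : IsPolytope P) (hE : IsFace P E) :
    ∃ Q ψ, DQ P E Q ψ := by
  by_cases hE0 : E = ∅
  · subst hE0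
    refine ⟨P, id, ⟨hP, ?_, ?_⟩, ?_⟩
    · refine ⟨fun G hG => hG.1, Function.injective_id.injOn, fun G hG => ⟨G, ⟨hG, ?_⟩, rfl⟩⟩
      exact Set.empty_subset G
    · intro G₁ _ G₂ _; rfl
    · intro G _ _; simp [pdim_empty]
  obtain ⟨l₀, c₀, hl₀, hEeq⟩ := hE.functional hE0
  obtain ⟨p, hp⟩ := Set.nonempty_iff_ne_empty.2 hE0
  obtain ⟨S, rfl⟩ := hP
  obtain ⟨π, hker, hπ⟩ := exists_proj (vectorSpan ℝ E)
  have hS : ∀ w ∈ S, w ∈ convexHull ℝ (S : Set (Fin d → ℝ)) :=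
    fun w hw => subset_convexHull ℝ _ hw
  have hpP := hE.subset hp
  -- the functional `l`, nonnegative on `P - p`
  set l : (Fin d → ℝ) →ₗ[ℝ] ℝ := -l₀ with hl
  have hlp : l₀ p = c₀ := by rw [hEeq] at hp; exact hp.2
  have hlnonneg : ∀ w ∈ S, 0 ≤ l (w - p) := by
    intro w hw
    have := hl₀ w (hS w hw)
    simp only [hl, LinearMap.neg_apply, map_sub, hlp]; linarith
  have hlE : ∀ w ∈ S, (l (w - p) = 0 ↔ w ∈ E) := by
    intro w hw
    rw [hEeq]
    simp only [hl, LinearMap.neg_apply, map_sub, hlp]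
    constructor
    · intro h; exact ⟨hS w hw, by linarith⟩
    · rintro ⟨_, h⟩; linarith
  -- functionals constant on `E` factor through `π`
  have hfac : ∀ f : (Fin d → ℝ) →ₗ[ℝ] ℝ, (∀ x ∈ E, f x = f p) → ∀ x, f (π x) = f x := by
    intro f hf x
    have hk : vectorSpan ℝ E ≤ LinearMap.ker f := by
      rw [vectorSpan_def, Submodule.span_le]
      rintro _ ⟨x, hx, b, hb, rfl⟩
      simp [hf x hx, hf b hb]
    have := hk (hπ x)
    rw [LinearMap.mem_ker, map_sub] at this
    linarith
  have hlπ : ∀ x, l (π x) = l x := by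
    apply hfac
    intro x hx
    rw [hEeq] at hx
    simp [hl, hx.2, hlp]
  have hπE : ∀ w ∈ E, π (w - p) = 0 := by
    intro w hw
    rw [← LinearMap.mem_ker, hker]
    exact vsub_mem_vectorSpan ℝ hw hp
  set τ : (Fin d → ℝ) → (Fin d → ℝ) := fun w => (l (w - p))⁻¹ • π (w - p) with hτ
  have hlτ : ∀ w ∈ S, w ∉ E → l (τ w) = 1 := by
    intro w hw hwE
    have : l (w - p) ≠ 0 := fun h => hwE ((hlE w hw).1 h)
    rw [hτ]
    simp only [map_smul, hlπ, smul_eq_mul]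
    exact inv_mul_cancel₀ this
  have hpos : ∀ w ∈ S, w ∉ E → 0 < l (w - p) := by
    intro w hw hwE
    exact lt_of_le_of_ne (hlnonneg w hw) fun h => hwE ((hlE w hw).1 h.symm)
  set B : Set (Fin d → ℝ) → Set (Fin d → ℝ) := fun G => τ '' {w ∈ (S : Set (Fin d → ℝ)) | w ∉ E ∧ w ∈ G}
    with hB
  set ψ : Set (Fin d → ℝ) → Set (Fin d → ℝ) := fun G => convexHull ℝ (B G) with hψ
  set T : Set (Fin d → ℝ) := τ '' {w ∈ (S : Set (Fin d → ℝ)) | w ∉ E} with hT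
  set Q : Set (Fin d → ℝ) := convexHull ℝ T with hQ
  have hQpoly : IsPolytope Q := by
    refine ⟨(S.filter (· ∉ E)).image τ, ?_⟩
    simp [hQ, hT]
  -- (i)
  have hface : ∀ G, IsFace (convexHull ℝ (S : Set (Fin d → ℝ))) G → E ⊆ G →
      ∃ f : (Fin d → ℝ) →ₗ[ℝ] ℝ, (∀ y ∈ T, f y ≤ 0) ∧ ψ G = {y ∈ Q | f y = 0} ∧
        ∀ w ∈ S, w ∉ E → (f (τ w) = 0 ↔ w ∈ G) := by
    intro G hG hEG
    have hGne : G ≠ ∅ := by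
      rintro rfl; exact hE0 (Set.subset_empty_iff.1 hEG)
    obtain ⟨f, c, hf, hGeq⟩ := hG.functional hGne
    have hfE : ∀ x ∈ E, f x = c := by
      intro x hx
      have := hEG hx
      rw [hGeq] at this
      exact this.2
    have hfπ := hfac f (fun x hx => by rw [hfE x hx, hfE p hp])
    have hfτ : ∀ w, f (τ w) = (l (w - p))⁻¹ * (f w - c) := by
      intro w
      simp only [hτ, map_smul, smul_eq_mul, hfπ, map_sub, hfE p hp]
    have hiff : ∀ w ∈ S, w ∉ E → (f (τ w) = 0 ↔ w ∈ G) := by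
      intro w hw hwE
      rw [hfτ, mul_eq_zero, inv_eq_zero, or_iff_right (hpos w hw hwE).ne', hGeq, sub_eq_zero]
      exact ⟨fun h => ⟨hS w hw, h⟩, fun h => h.2⟩
    have hle : ∀ y ∈ T, f y ≤ 0 := by
      rintro _ ⟨w, ⟨hw, hwE⟩, rfl⟩
      rw [hfτ]
      exact mul_nonpos_of_nonneg_of_nonpos (inv_nonneg.2 (hlnonneg w hw))
        (by have := hf w (hS w hw); linarith)
    refine ⟨f, hle, ?_, hiff⟩
    rw [hQ, face_hull T f 0 hle]
    simp only [hψ]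
    congr 1
    ext y
    constructor
    · rintro ⟨w, ⟨hw, hwE, hwG⟩, rfl⟩
      exact ⟨⟨w, ⟨hw, hwE⟩, rfl⟩, (hiff w hw hwE).2 hwG⟩
    · rintro ⟨⟨w, ⟨hw, hwE⟩, rfl⟩, h0⟩
      exact ⟨w, ⟨hw, hwE, (hiff w hw hwE).1 h0⟩, rfl⟩
  have hord : ∀ G₁ G₂, IsFace (convexHull ℝ (S : Set (Fin d → ℝ))) G₁ → E ⊆ G₁ →
      IsFace (convexHull ℝ (S : Set (Fin d → ℝ))) G₂ → E ⊆ G₂ → (G₁ ⊆ G₂ ↔ ψ G₁ ⊆ ψ G₂) := by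
    intro G₁ G₂ h1 h1' h2 h2'
    constructor
    · intro h
      exact convexHull_mono (Set.image_mono fun w hw => ⟨hw.1, hw.2.1, h hw.2.2⟩)
    · intro h
      rw [h1.eq_hull, h2.eq_hull]
      apply convexHull_mono
      rintro w ⟨hw, hwG⟩
      refine ⟨hw, ?_⟩
      by_cases hwE : w ∈ E
      · exact h2' hwE
      · obtain ⟨f, hf, hψ2, hiff⟩ := hface G₂ h2 h2'
        have : τ w ∈ ψ G₁ := subset_convexHull ℝ _ ⟨w, ⟨hw, hwE, hwG⟩, rfl⟩
        have := h this
        rw [hψ2] at this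
        exact (hiff w hw hwE).1 this.2
  refine ⟨Q, ψ, ⟨hQpoly, ⟨?_, ?_, ?_⟩, ?_⟩, ?_⟩
  · rintro G ⟨hG, hEG⟩
    obtain ⟨f, hf, hψ2, hiff⟩ := hface G hG hEG
    exact Or.inr (Or.inr ⟨f, 0, hull_le _ _ _ hf, hψ2⟩)
  · rintro G₁ ⟨h1, h1'⟩ G₂ ⟨h2, h2'⟩ heq
    exact Set.Subset.antisymm ((hord _ _ h1 h1' h2 h2').2 heq.le)
      ((hord _ _ h2 h2' h1 h1').2 heq.ge)
  · intro H hH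
    have hH' : IsFace Q H := hH
    by_cases hH0 : H = ∅
    · refine ⟨E, ⟨hE, subset_rfl⟩, ?_⟩
      have : {w ∈ (S : Set (Fin d → ℝ)) | w ∉ E ∧ w ∈ E} = ∅ := by
        ext w; simp
      simp only [hψ, hB, this, hH0, Set.image_empty, convexHull_empty]
    obtain ⟨f, c, hf, hHeq⟩ := hH'.functional hH0
    set f₁ : (Fin d → ℝ) →ₗ[ℝ] ℝ := (f - c • l) ∘ₗ π with hf₁
    have hval : ∀ w ∈ S, w ∉ E → f₁ (w - p) = l (w - p) * (f (τ w) - c) := by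
      intro w hw hwE
      have h0 := (hpos w hw hwE).ne'
      simp only [hf₁, LinearMap.comp_apply, LinearMap.sub_apply, LinearMap.smul_apply, hlπ,
        smul_eq_mul, hτ, map_smul]
      field_simp
    have hvalE : ∀ w ∈ E, f₁ w = f₁ p := by
      intro w hw
      have := hπE w hw
      rw [← sub_eq_zero, ← map_sub, hf₁, LinearMap.comp_apply, this, map_zero]
    have hTQ : ∀ w ∈ S, w ∉ E → τ w ∈ T := fun w hw hwE => ⟨w, ⟨hw, hwE⟩, rfl⟩
    have hle : ∀ w ∈ (S : Set (Fin d → ℝ)), f₁ w ≤ f₁ p := by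
      intro w hw
      by_cases hwE : w ∈ E
      · exact (hvalE w hwE).le
      · rw [← sub_nonpos, ← map_sub, hval w hw hwE]
        exact mul_nonpos_of_nonneg_of_nonpos (hlnonneg w hw)
          (by have := hf _ (subset_convexHull ℝ _ (hTQ w hw hwE)); linarith)
    set G := {x ∈ convexHull ℝ (S : Set (Fin d → ℝ)) | f₁ x = f₁ p} with hG
    have hGface : IsFace (convexHull ℝ (S : Set (Fin d → ℝ))) G :=
      Or.inr (Or.inr ⟨f₁, f₁ p, hull_le _ _ _ hle, hG⟩)
    refine ⟨G, ⟨hGface, fun x hx => ⟨hE.subset hx, hvalE x hx⟩⟩, ?_⟩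
    have hTle : ∀ y ∈ T, f y ≤ c := fun y hy => hf y (subset_convexHull ℝ _ hy)
    rw [hHeq, hQ, face_hull T f c hTle]
    simp only [hψ]
    congr 1
    have hiff : ∀ w ∈ S, w ∉ E → (f (τ w) = c ↔ w ∈ G) := by
      intro w hw hwE
      have h1 : w ∈ G ↔ f₁ (w - p) = 0 := by
        rw [map_sub, sub_eq_zero]
        exact ⟨fun h => h.2, fun h => ⟨hS w hw, h⟩⟩
      rw [h1, hval w hw hwE, mul_eq_zero, or_iff_right (hpos w hw hwE).ne', sub_eq_zero]
    ext y
    constructor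
    · rintro ⟨w, ⟨hw, hwE, hwG⟩, rfl⟩
      exact ⟨⟨w, ⟨hw, hwE⟩, rfl⟩, (hiff w hw hwE).2 hwG⟩
    · rintro ⟨⟨w, ⟨hw, hwE⟩, rfl⟩, h0⟩
      exact ⟨w, ⟨hw, hwE, (hiff w hw hwE).1 h0⟩, rfl⟩
  · rintro G₁ ⟨h1, h1'⟩ G₂ ⟨h2, h2'⟩
    exact hord G₁ G₂ h1 h1' h2 h2'
  · intro G hG hEG
    have hGne : G ≠ ∅ := by
      rintro rfl; exact hE0 (Set.subset_empty_iff.1 hEG)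
    have h1 : (Module.finrank ℝ (Submodule.span ℝ (B G)) : ℤ) = pdim (ψ G) + 1 := by
      rw [finrank_span_of_level (B G) l, pdim_hull]
      rintro _ ⟨w, ⟨hw, hwE, _⟩, rfl⟩
      exact hlτ w hw hwE
    -- the vertices of `G`
    have hspanG : vectorSpan ℝ G =
        vectorSpan ℝ (insert p {w ∈ (S : Set (Fin d → ℝ)) | w ∈ G}) := by
      apply le_antisymm
      · conv_lhs => rw [hG.eq_hull, ← direction_affineSpan, affineSpan_convexHull,
          direction_affineSpan]
        exact vectorSpan_mono ℝ (Set.subset_insert _ _)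
      · apply vectorSpan_mono
        rintro x (rfl | hx)
        · exact hEG hp
        · exact hx.2
    have hmap : Submodule.map π (vectorSpan ℝ G) = Submodule.span ℝ (B G) := by
      apply le_antisymm
      · rw [hspanG, vectorSpan_eq_span_vsub_set_right ℝ (Set.mem_insert p _), Submodule.map_span,
          Submodule.span_le]
        rintro _ ⟨_, ⟨w, hw, rfl⟩, rfl⟩
        simp only [vsub_eq_sub, SetLike.mem_coe]
        by_cases hwE : w ∈ E
        · rw [hπE w hwE]; exact Submodule.zero_mem _
        · rcases hw with rfl | hw
          · exact absurd hp hwE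
          have h0 := (hpos w hw.1 hwE).ne'
          have : π (w - p) = l (w - p) • τ w := by
            simp only [hτ, smul_smul, mul_inv_cancel₀ h0, one_smul]
          rw [this]
          exact Submodule.smul_mem _ _ (Submodule.subset_span ⟨w, ⟨hw.1, hwE, hw.2⟩, rfl⟩)
      · rw [Submodule.span_le]
        rintro _ ⟨w, ⟨hw, hwE, hwG⟩, rfl⟩
        exact Submodule.smul_mem _ _
          (Submodule.mem_map_of_mem (vsub_mem_vectorSpan ℝ hwG (hEG hp)))
    have h2 := LinearMap.finrank_range_add_finrank_ker (π.domRestrict (vectorSpan ℝ G))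
    have h3 : LinearMap.range (π.domRestrict (vectorSpan ℝ G)) = Submodule.span ℝ (B G) := by
      rw [← hmap, LinearMap.range_domRestrict]
    have h4 : Module.finrank ℝ (LinearMap.ker (π.domRestrict (vectorSpan ℝ G))) =
        Module.finrank ℝ (vectorSpan ℝ E) := by
      rw [LinearMap.ker_domRestrict, hker]
      exact LinearEquiv.finrank_eq (Submodule.submoduleOfEquivOfLe (vectorSpan_mono ℝ hEG))
    rw [h3, h4] at h2
    rw [pdim_of_ne hGne, pdim_of_ne hE0, ← h2]
    push_cast
    linarith

end Quotient
section GPart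
variable {d : ℕ}

/-- The finset of faces of a polytope. -/
def fcs (P : Set (Fin d → ℝ)) : Finset (Set (Fin d → ℝ)) :=
  if h : {G | IsFace P G}.Finite then h.toFinset else ∅

lemma mem_fcs {P G : Set (Fin d → ℝ)} (hP : IsPolytope P) : G ∈ fcs P ↔ IsFace P G := by
  rw [fcs, dif_pos (finite_faces hP)]
  simp

/-- The additive operator in the recursion of `g`. -/
def gOp (q r : ℤ) : ℤ[X] →+ ℤ[X] where
  toFun p := ∑ i ∈ Finset.range (q.toNat / 2 + 1),
    monomial i (((1 - X) * ((X - 1) ^ (q - r - 1).toNat * p)).coeff i)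
  map_zero' := by simp
  map_add' x y := by
    simp only [mul_add, coeff_add, map_add, Finset.sum_add_distrib]

lemma g_rec {g h : Set (Fin d → ℝ) → ℤ[X]} (hGH : IsGH g h) {Q : Set (Fin d → ℝ)}
    (hQ : IsPolytope Q) (hne : Q ≠ ∅) :
    g Q = ∑ H ∈ fcs Q with H ≠ Q, gOp (pdim Q) (pdim H) (g H) := by
  have hh : h Q = ∑ H ∈ fcs Q with H ≠ Q, (X - 1 : ℤ[X]) ^ (pdim Q - pdim H - 1).toNat * g H := by
    rw [hGH.2.1 Q hQ, ← finsum_mem_coe_finset]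
    congr 1
    ext H
    simp [mem_fcs hQ]
  have hg : g Q = ∑ i ∈ Finset.range ((pdim Q).toNat / 2 + 1),
      monomial i (((1 - X) * h Q).coeff i) := by
    have h0 := pdim_nonneg hne
    obtain ⟨h1, h2, h3⟩ := hGH.2.2 Q hQ hne
    ext j
    simp only [finsetSum_coeff, coeff_monomial]
    rw [Finset.sum_ite_eq']
    rcases Nat.eq_zero_or_pos j with rfl | hj
    · simp [h1, sub_mul, mul_coeff_zero]
    · by_cases hc : 2 * (j : ℤ) ≤ pdim Q
      · rw [if_pos (by rw [Finset.mem_range]; omega), h2 j hj hc]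
        obtain ⟨m, rfl⟩ : ∃ m, j = m + 1 := ⟨j - 1, by omega⟩
        simp [sub_mul, coeff_X_mul]
      · rw [if_neg (by rw [Finset.mem_range]; omega), h3 j hj hc]
  rw [hg, hh]
  simp only [gOp, AddMonoidHom.coe_mk, ZeroHom.coe_mk]
  rw [Finset.sum_comm]
  refine Finset.sum_congr rfl fun i _ => ?_
  rw [Finset.mul_sum, finsetSum_coeff, map_sum]

lemma DQ.sub {P E Q G : Set (Fin d → ℝ)} {ψ : Set (Fin d → ℝ) → Set (Fin d → ℝ)}
    (hP : IsPolytope P) (h : DQ P E Q ψ) (hG : IsFace P G) (hEG : E ⊆ G) : DQ G E (ψ G) ψ := by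
  obtain ⟨⟨hQ, hbij, hord⟩, hdim⟩ := h
  have hψG : IsFace Q (ψ G) := hbij.mapsTo ⟨hG, hEG⟩
  refine ⟨⟨hψG.isPolytope hQ, ⟨?_, ?_, ?_⟩, ?_⟩, ?_⟩
  · rintro K ⟨hK, hEK⟩
    have hKP := hG.trans hP hK
    have h1 : IsFace Q (ψ K) := hbij.mapsTo ⟨hKP, hEK⟩
    exact h1.restrict hψG.subset ((hord K ⟨hKP, hEK⟩ G ⟨hG, hEG⟩).1 hK.subset)
  · rintro K ⟨hK, hEK⟩ K' ⟨hK', hEK'⟩ heq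
    exact hbij.injOn ⟨hG.trans hP hK, hEK⟩ ⟨hG.trans hP hK', hEK'⟩ heq
  · intro H hH
    have hH' : IsFace (ψ G) H := hH
    obtain ⟨K, ⟨hK, hEK⟩, rfl⟩ := hbij.surjOn (hψG.trans hQ hH')
    have := (hord K ⟨hK, hEK⟩ G ⟨hG, hEG⟩).2 hH'.subset
    exact ⟨K, ⟨hK.restrict hG.subset this, hEK⟩, rfl⟩
  · rintro K ⟨hK, hEK⟩ K' ⟨hK', hEK'⟩
    exact hord K ⟨hG.trans hP hK, hEK⟩ K' ⟨hG.trans hP hK', hEK'⟩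
  · intro K hK hEK
    exact hdim K (hG.trans hP hK) hEK

lemma DQ.top {P E Q : Set (Fin d → ℝ)} {ψ : Set (Fin d → ℝ) → Set (Fin d → ℝ)}
    (h : DQ P E Q ψ) (hE : IsFace P E) : ψ P = Q := by
  obtain ⟨⟨hQ, hbij, hord⟩, hdim⟩ := h
  have hPm : P ∈ {G | IsFace P G ∧ E ⊆ G} := ⟨IsFace.refl P, hE.subset⟩
  have h1 : IsFace Q (ψ P) := hbij.mapsTo hPm
  obtain ⟨K, hK, hKQ⟩ := hbij.surjOn (show Q ∈ {G | IsFace Q G} from IsFace.refl Q)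
  apply Set.Subset.antisymm h1.subset
  rw [← hKQ]
  exact (hord K hK P hPm).1 hK.1.subset

lemma DQ.rec_g {g h : Set (Fin d → ℝ) → ℤ[X]} (hGH : IsGH g h)
    {P E Q : Set (Fin d → ℝ)} {ψ : Set (Fin d → ℝ) → Set (Fin d → ℝ)}
    (hP : IsPolytope P) (hE : IsFace P E) (hDQ : DQ P E Q ψ) (hne : E ≠ P) :
    g Q = ∑ G ∈ fcs P with E ⊆ G ∧ G ≠ P,
      gOp (pdim P - pdim E - 1) (pdim G - pdim E - 1) (g (ψ G)) := by
  have htop := hDQ.top hE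
  have hlt := pdim_lt hE hne
  have hdQ : pdim Q = pdim P - pdim E - 1 := by
    rw [← htop]; exact hDQ.2 P (IsFace.refl P) hE.subset
  have hQne : Q ≠ ∅ := by
    intro h0
    rw [h0, pdim_empty] at hdQ
    omega
  obtain ⟨⟨hQ, hbij, hord⟩, hdim⟩ := hDQ
  rw [g_rec hGH hQ hQne]
  symm
  refine Finset.sum_bij (fun G _ => ψ G) ?_ ?_ ?_ ?_
  · intro G hG
    simp only [Finset.mem_filter, mem_fcs hP, mem_fcs hQ] at hG ⊢
    refine ⟨hbij.mapsTo ⟨hG.1, hG.2.1⟩, fun heq => hG.2.2 ?_⟩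
    exact hbij.injOn ⟨hG.1, hG.2.1⟩ ⟨IsFace.refl P, hE.subset⟩ (heq.trans htop.symm)
  · intro G hG G' hG' heq
    simp only [Finset.mem_filter, mem_fcs hP] at hG hG'
    exact hbij.injOn ⟨hG.1, hG.2.1⟩ ⟨hG'.1, hG'.2.1⟩ heq
  · intro H hH
    simp only [Finset.mem_filter, mem_fcs hQ] at hH
    obtain ⟨G, hG, rfl⟩ := hbij.surjOn (show H ∈ {G | IsFace Q G} from hH.1)
    refine ⟨G, ?_, rfl⟩
    simp only [Finset.mem_filter, mem_fcs hP]
    refine ⟨hG.1, hG.2, ?_⟩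
    rintro rfl
    exact hH.2 htop
  · intro G hG
    simp only [Finset.mem_filter, mem_fcs hP] at hG
    rw [hdQ, hdim G hG.1 hG.2.1]

lemma DQ.inv {g h : Set (Fin d → ℝ) → ℤ[X]} (hGH : IsGH g h) (m : ℕ) :
    ∀ (P E Q Q' : Set (Fin d → ℝ)) (ψ ψ' : Set (Fin d → ℝ) → Set (Fin d → ℝ)),
    pdim P + 1 = m → IsPolytope P → IsFace P E → DQ P E Q ψ → DQ P E Q' ψ' → g Q = g Q' := by
  induction m using Nat.strong_induction_on with
  | _ m ih =>
    intro P E Q Q' ψ ψ' hm hP hE h1 h2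
    by_cases hne : E = P
    · subst hne
      have e1 := h1.2 E (IsFace.refl E) subset_rfl
      have e2 := h2.2 E (IsFace.refl E) subset_rfl
      rw [h1.top hE] at e1
      rw [h2.top hE] at e2
      rw [pdim_eq_neg_one.1 (by omega : pdim Q = -1), pdim_eq_neg_one.1 (by omega : pdim Q' = -1)]
    · rw [h1.rec_g hGH hP hE hne, h2.rec_g hGH hP hE hne]
      refine Finset.sum_congr rfl fun G hG => ?_
      simp only [Finset.mem_filter, mem_fcs hP] at hG
      obtain ⟨hG, hEG, hGP⟩ := hG
      congr 1
      have hlt := pdim_lt hG hGP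
      have hge := pdim_ge G
      exact ih (pdim G + 1).toNat (by omega) G E _ _ ψ ψ' (by omega) (hG.isPolytope hP)
        (hE.restrict hG.subset hEG) (h1.sub hP hG hEG) (h2.sub hP hG hEG)

/-- A chosen quotient polytope. -/
def quot (P E : Set (Fin d → ℝ)) : Set (Fin d → ℝ) :=
  if h : ∃ Q ψ, DQ P E Q ψ then h.choose else ∅

lemma quot_spec {P E : Set (Fin d → ℝ)} (hP : IsPolytope P) (hE : IsFace P E) :
    ∃ ψ, DQ P E (quot P E) ψ := by
  have h := exists_DQ hP hE
  rw [quot, dif_pos h]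
  exact h.choose_spec

lemma gquot_self {g h : Set (Fin d → ℝ) → ℤ[X]} (hGH : IsGH g h) {P : Set (Fin d → ℝ)}
    (hP : IsPolytope P) : g (quot P P) = 1 := by
  obtain ⟨ψ, h1⟩ := quot_spec hP (IsFace.refl P)
  have e1 := h1.2 P (IsFace.refl P) subset_rfl
  rw [h1.top (IsFace.refl P)] at e1
  rw [pdim_eq_neg_one.1 (by omega : pdim (quot P P) = -1), hGH.1]

lemma DQ_empty {P : Set (Fin d → ℝ)} (hP : IsPolytope P) : DQ P ∅ P id := by
  refine ⟨⟨hP, ?_, ?_⟩, ?_⟩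
  · refine ⟨fun G hG => hG.1, Function.injective_id.injOn, fun G hG => ⟨G, ⟨hG, ?_⟩, rfl⟩⟩
    exact Set.empty_subset G
  · intro G₁ _ G₂ _; rfl
  · intro G _ _; simp [pdim_empty]

lemma gquot_empty {g h : Set (Fin d → ℝ) → ℤ[X]} (hGH : IsGH g h) {P : Set (Fin d → ℝ)}
    (hP : IsPolytope P) : g (quot P ∅) = g P := by
  obtain ⟨ψ, h1⟩ := quot_spec hP (IsFace.empty P)
  have := pdim_ge P
  exact DQ.inv hGH (pdim P + 1).toNat P ∅ _ _ ψ id (by omega) hP (IsFace.empty P) h1 (DQ_empty hP)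

lemma gquot_rec {g h : Set (Fin d → ℝ) → ℤ[X]} (hGH : IsGH g h) {P E : Set (Fin d → ℝ)}
    (hP : IsPolytope P) (hE : IsFace P E) (hne : E ≠ P) :
    g (quot P E) = ∑ G ∈ fcs P with E ⊆ G ∧ G ≠ P,
      gOp (pdim P - pdim E - 1) (pdim G - pdim E - 1) (g (quot G E)) := by
  obtain ⟨ψ, h1⟩ := quot_spec hP hE
  rw [h1.rec_g hGH hP hE hne]
  refine Finset.sum_congr rfl fun G hG => ?_
  simp only [Finset.mem_filter, mem_fcs hP] at hG
  obtain ⟨hG, hEG, hGP⟩ := hG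
  obtain ⟨ψ', h2⟩ := quot_spec (hG.isPolytope hP) (hE.restrict hG.subset hEG)
  have hge := pdim_ge G
  rw [DQ.inv hGH (pdim G + 1).toNat G E _ _ ψ ψ' (by omega) (hG.isPolytope hP)
        (hE.restrict hG.subset hEG) (h1.sub hP hG hEG) h2]

lemma gr_rec {g h : Set (Fin d → ℝ) → ℤ[X]} (hGH : IsGH g h)
    {gr : Set (Fin d → ℝ) → Set (Fin d → ℝ) → ℤ[X]} (hgr : IsRelG g gr) {P F : Set (Fin d → ℝ)}
    (hP : IsPolytope P) (hF : IsFace P F) :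
    gr P F = g P - ∑ E ∈ fcs P with F ⊆ E ∧ E ≠ P, gr E F * g (quot P E) := by
  have h1 : ∀ E, ∃ ψ, IsFace P E → DQ P E (quot P E) ψ := by
    intro E
    by_cases hE : IsFace P E
    · obtain ⟨ψ, h⟩ := quot_spec hP hE
      exact ⟨ψ, fun _ => h⟩
    · exact ⟨id, fun h => absurd h hE⟩
  choose ψ hψ using h1
  have h2 := hgr P F (quot P) ψ hP hF (fun E hE _ => (hψ E hE).1)
  have h3 : (∑ᶠ E ∈ {E : Set (Fin d → ℝ) | IsFace P E ∧ F ⊆ E}, gr E F * g (quot P E)) =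
      ∑ E ∈ fcs P with F ⊆ E, gr E F * g (quot P E) := by
    rw [← finsum_mem_coe_finset]
    congr 1
    ext E
    simp [mem_fcs hP]
  rw [h3, ← Finset.add_sum_erase (a := P) _ _
    (by simp [mem_fcs hP, IsFace.refl, hF.subset]), gquot_self hGH hP, mul_one] at h2
  rw [← h2]
  have h4 : (fcs P).filter (fun E => F ⊆ E ∧ E ≠ P) = ((fcs P).filter (fun E => F ⊆ E)).erase P := by
    ext E
    simp only [Finset.mem_filter, Finset.mem_erase]
    tauto
  rw [h4]
  ring

end GPart
section Flags
variable {d : ℕ}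

/-- Valid pairs `(P, F)`. -/
def Valid (e D : ℤ) (P F : Set (Fin d → ℝ)) : Prop :=
  IsPolytope P ∧ pdim P = D ∧ IsFace P F ∧ pdim F = e

/-- Functions of `(P, F)` which, on valid pairs, are combinations of flag numbers whose
top face is `P`. -/
inductive InV (e D : ℤ) : (Set (Fin d → ℝ) → Set (Fin d → ℝ) → ℤ[X]) → Prop
  | gen (n : ℕ) (I : Fin n → ℤ) (k : Fin n) (c : ℤ[X]) (hI : StrictMono I)
      (hb : ∀ j, -1 ≤ I j ∧ I j ≤ D) (ht : ∃ j, I j = D) :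
      InV e D (fun P F => c * (relFlag n I k P F : ℤ[X]))
  | zero : InV e D (fun _ _ => 0)
  | add (φ φ' : Set (Fin d → ℝ) → Set (Fin d → ℝ) → ℤ[X]) :
      InV e D φ → InV e D φ' → InV e D (fun P F => φ P F + φ' P F)
  | congr (φ φ' : Set (Fin d → ℝ) → Set (Fin d → ℝ) → ℤ[X]) :
      (∀ P F, Valid e D P F → φ P F = φ' P F) → InV e D φ → InV e D φ'

lemma InV.sum {e D : ℤ} {ι : Type*} (s : Finset ι)
    (φ : ι → Set (Fin d → ℝ) → Set (Fin d → ℝ) → ℤ[X]) (h : ∀ i ∈ s, InV e D (φ i)) :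
    InV e D (fun P F => ∑ i ∈ s, φ i P F) := by
  induction s using Finset.induction_on with
  | empty => simpa using InV.zero
  | insert a s ha ih =>
    simp only [Finset.sum_insert ha]
    exact InV.add _ _ (h a (by simp)) (ih fun i hi => h i (by simp [hi]))

lemma InV.map {e D : ℤ} (T : ℤ[X] →+ ℤ[X]) {φ : Set (Fin d → ℝ) → Set (Fin d → ℝ) → ℤ[X]}
    (h : InV e D φ) : InV e D (fun P F => T (φ P F)) := by
  induction h with
  | gen n I k c hI hb ht =>
    refine InV.congr _ _ (fun P F _ => ?_) (InV.gen n I k (T c) hI hb ht)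
    show T c * (relFlag n I k P F : ℤ[X]) = T (c * (relFlag n I k P F : ℤ[X]))
    rw [mul_comm c, ← nsmul_eq_mul, map_nsmul, nsmul_eq_mul, mul_comm]
  | zero => simpa using InV.zero
  | add φ φ' _ _ h1 h2 =>
    simp only [map_add]
    exact InV.add _ _ h1 h2
  | congr φ φ' heq _ h =>
    exact InV.congr _ _ (fun P F hv => by rw [heq P F hv]) h

lemma finite_chains {P : Set (Fin d → ℝ)} (hP : IsPolytope P) (F : Set (Fin d → ℝ)) (n : ℕ)
    (I : Fin n → ℤ) (k : Fin n) :
    {c : Fin n → Set (Fin d → ℝ) |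
      StrictMono c ∧ (∀ j, IsFace P (c j) ∧ pdim (c j) = I j) ∧ F ⊆ c k}.Finite := by
  refine Set.Finite.subset (Set.Finite.pi' (t := fun _ : Fin n => {G | IsFace P G})
    (fun _ => finite_faces hP)) ?_
  rintro c ⟨_, h, _⟩ j
  exact (h j).1

lemma face_eq_of_pdim {P G : Set (Fin d → ℝ)} (hG : IsFace P G) (h : pdim G = pdim P) : G = P := by
  by_contra hne
  exact (pdim_lt hG hne).ne h

lemma relFlag_snoc {P F : Set (Fin d → ℝ)} (hP : IsPolytope P) {n : ℕ} {I : Fin n → ℤ} {k : Fin n}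
    {D D' : ℤ} (hD : pdim P = D) (hI : StrictMono I) (hle : ∀ j, I j ≤ D') (ht : ∃ j, I j = D')
    (hlt : D' < D) :
    relFlag (n + 1) (Fin.snoc (α := fun _ => ℤ) I D) k.castSucc P F =
      ∑ G ∈ fcs P with (F ⊆ G ∧ pdim G = D'), relFlag n I k G F := by
  obtain ⟨j0, hj0⟩ := ht
  have hj : ∀ j, j ≤ j0 := fun j => hI.le_iff_le.1 (by rw [hj0]; exact hle j)
  have hfin := finite_chains hP F (n + 1) (Fin.snoc (α := fun _ => ℤ) I D) k.castSucc
  rw [relFlag, Set.ncard_eq_toFinset_card _ hfin,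
    Finset.card_eq_sum_card_fiberwise (f := fun c => c j0.castSucc)
      (t := (fcs P).filter fun G => F ⊆ G ∧ pdim G = D')]
  · refine Finset.sum_congr rfl fun G hG => ?_
    simp only [Finset.mem_filter, mem_fcs hP] at hG
    obtain ⟨hG, hFG, hGD⟩ := hG
    rw [← Set.ncard_coe_finset, relFlag]
    symm
    refine Set.ncard_congr (fun c _ => Fin.snoc (α := fun _ => Set (Fin d → ℝ)) c P) ?_ ?_ ?_
    · rintro c ⟨hc, hcf, hck⟩
      have hcj0 : c j0 = G := face_eq_of_pdim (hcf j0).1 (by rw [(hcf j0).2, hj0, hGD])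
      simp only [Finset.coe_filter, Set.Finite.mem_toFinset, Set.mem_ofPred_eq, Fin.snoc_castSucc]
      refine ⟨⟨?_, ?_, hck⟩, hcj0⟩
      · intro i j hij
        induction j using Fin.lastCases with
        | last =>
          induction i using Fin.lastCases with
          | last => exact absurd hij (lt_irrefl _)
          | cast i =>
            rw [Fin.snoc_castSucc, Fin.snoc_last]
            refine lt_of_le_of_lt (hcf i).1.subset (lt_of_le_of_ne hG.subset ?_)
            rintro rfl
            omega
        | cast j =>
          induction i using Fin.lastCases with
          | last => exact absurd hij (not_lt.2 (Fin.le_last _))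
          | cast i =>
            rw [Fin.snoc_castSucc, Fin.snoc_castSucc]
            exact hc (by simpa using hij)
      · intro j
        induction j using Fin.lastCases with
        | last => simpa using ⟨IsFace.refl P, hD⟩
        | cast j => simpa using ⟨hG.trans hP (hcf j).1, (hcf j).2⟩
    · intro a b _ _ hab
      funext j
      have := congrFun hab j.castSucc
      simpa using this
    · intro b hb
      simp only [Finset.coe_filter, Set.Finite.mem_toFinset, Set.mem_ofPred_eq] at hb
      obtain ⟨⟨hb, hbf, hbk⟩, hbG⟩ := hb
      refine ⟨fun j => b j.castSucc, ⟨?_, ?_, hbk⟩, ?_⟩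
      · intro i j hij
        exact hb (by simpa using hij)
      · intro j
        have h1 := hbf j.castSucc
        rw [Fin.snoc_castSucc] at h1
        refine ⟨h1.1.restrict hG.subset ?_, h1.2⟩
        rw [← hbG]
        exact hb.monotone (by simpa using hj j)
      · funext j
        induction j using Fin.lastCases with
        | last =>
          have h1 := hbf (Fin.last n)
          rw [Fin.snoc_last] at h1
          rw [Fin.snoc_last, face_eq_of_pdim h1.1 (by rw [h1.2, hD])]
        | cast j => simp
  · intro c hc
    simp only [Set.Finite.coe_toFinset, Set.mem_ofPred_eq] at hc
    obtain ⟨hc, hcf, hck⟩ := hc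
    have h1 := hcf j0.castSucc
    rw [Fin.snoc_castSucc] at h1
    simp only [Finset.coe_filter, Set.mem_ofPred_eq, mem_fcs hP]
    exact ⟨h1.1, hck.trans (hc.monotone (by simpa using hj k)), h1.2.trans hj0⟩

lemma InV.ext {e D D' : ℤ} (hlt : D' < D) {φ : Set (Fin d → ℝ) → Set (Fin d → ℝ) → ℤ[X]}
    (h : InV e D' φ) :
    InV e D (fun P F => ∑ G ∈ fcs P with (F ⊆ G ∧ pdim G = D'), φ G F) := by
  induction h with
  | gen n I k c hI hb ht =>
    refine InV.congr _ _ ?_ (InV.gen (n + 1) (Fin.snoc (α := fun _ => ℤ) I D) k.castSucc c ?_ ?_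
      ⟨Fin.last n, by simp⟩)
    · rintro P F ⟨hP, hD, hF, he⟩
      rw [relFlag_snoc hP hD hI (fun j => (hb j).2) ht hlt, Nat.cast_sum, Finset.mul_sum]
    · intro i j hij
      induction j using Fin.lastCases with
      | last =>
        induction i using Fin.lastCases with
        | last => exact absurd hij (lt_irrefl _)
        | cast i =>
          rw [Fin.snoc_castSucc, Fin.snoc_last]
          exact lt_of_le_of_lt (hb i).2 hlt
      | cast j =>
        induction i using Fin.lastCases with
        | last => exact absurd hij (not_lt.2 (Fin.le_last _))
        | cast i =>
          rw [Fin.snoc_castSucc, Fin.snoc_castSucc]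
          exact hI (by simpa using hij)
    · intro j
      induction j using Fin.lastCases with
      | last =>
        obtain ⟨j0, hj0⟩ := ht
        have := (hb j0).1
        rw [Fin.snoc_last]
        omega
      | cast j =>
        rw [Fin.snoc_castSucc]
        have := hb j
        omega
  | zero => simpa using InV.zero
  | add φ φ' _ _ h1 h2 =>
    simp only [Finset.sum_add_distrib]
    exact InV.add _ _ h1 h2
  | congr φ φ' heq _ h =>
    refine InV.congr _ _ (fun P F hv => ?_) h
    refine Finset.sum_congr rfl fun G hG => ?_
    simp only [Finset.mem_filter, mem_fcs hv.1] at hG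
    exact heq G F ⟨hG.1.isPolytope hv.1, hG.2.2, hv.2.2.1.restrict hG.1.subset hG.2.1, hv.2.2.2⟩

lemma sum_by_dim (S : Finset (Set (Fin d → ℝ))) (F : Set (Fin d → ℝ)) (a D : ℤ)
    (f : ℤ → Set (Fin d → ℝ) → ℤ[X]) :
    ∑ D' ∈ Finset.Ico a D, ∑ G ∈ S with (F ⊆ G ∧ pdim G = D'), f D' G =
      ∑ G ∈ S with (F ⊆ G ∧ pdim G ∈ Finset.Ico a D), f (pdim G) G := by
  have : ∀ G ∈ S.filter (fun G => F ⊆ G ∧ pdim G ∈ Finset.Ico a D),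
      f (pdim G) G = ∑ D' ∈ {pdim G}, f D' G := by
    intro G _; simp
  rw [Finset.sum_congr rfl this]
  apply Finset.sum_comm'
  intro D' G
  simp only [Finset.mem_filter, Finset.mem_singleton]
  constructor
  · rintro ⟨h1, h2, h3, h4⟩
    exact ⟨h4.symm, h2, h3, h4 ▸ h1⟩
  · rintro ⟨rfl, h2, h3, h4⟩
    exact ⟨h4, h2, h3, rfl⟩

lemma claimB1 {g h : Set (Fin d → ℝ) → ℤ[X]} (hGH : IsGH g h) (e a : ℤ)
    (n : ℕ) (I : Fin n → ℤ) (k : Fin n) (hI : StrictMono I)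
    (hb : ∀ j, -1 ≤ I j ∧ I j ≤ a) (ht : ∃ j, I j = a) (m : ℕ) :
    ∀ D : ℤ, D = a + m → InV e D (fun P F => ∑ E ∈ fcs P with (F ⊆ E ∧ pdim E = a),
      (relFlag n I k E F : ℤ[X]) * g (quot P E)) := by
  induction m using Nat.strong_induction_on with
  | _ m ih =>
    intro D hD
    rcases Nat.eq_zero_or_pos m with rfl | hm
    · obtain rfl : D = a := by simpa using hD
      refine InV.congr _ _ ?_ (InV.gen n I k 1 hI hb ht)
      rintro P F ⟨hP, hPD, hF, he⟩
      rw [Finset.sum_eq_single P]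
      · rw [gquot_self hGH hP, one_mul, mul_one]
      · intro E hE hne
        simp only [Finset.mem_filter, mem_fcs hP] at hE
        exact absurd (face_eq_of_pdim hE.1 (by rw [hE.2.2, hPD])) hne
      · intro hcon
        refine absurd ?_ hcon
        simp only [Finset.mem_filter, mem_fcs hP]
        exact ⟨IsFace.refl P, hF.subset, hPD⟩
    · have key : InV e D (fun P F => ∑ D' ∈ Finset.Ico a D,
          ∑ G ∈ fcs P with (F ⊆ G ∧ pdim G = D'), gOp (D - a - 1) (D' - a - 1)
            (∑ E ∈ fcs G with (F ⊆ E ∧ pdim E = a),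
              (relFlag n I k E F : ℤ[X]) * g (quot G E))) := by
        refine InV.sum (d := d) (Finset.Ico a D) _ fun D' hD' => ?_
        rw [Finset.mem_Ico] at hD'
        refine InV.ext hD'.2 (InV.map (gOp (D - a - 1) (D' - a - 1)) ?_)
        exact ih (D' - a).toNat (by omega) D' (by omega)
      refine InV.congr _ _ ?_ key
      rintro P F ⟨hP, hPD, hF, he⟩
      rw [sum_by_dim (fcs P) F a D (fun D' G => gOp (D - a - 1) (D' - a - 1)
            (∑ E ∈ fcs G with (F ⊆ E ∧ pdim E = a),
              (relFlag n I k E F : ℤ[X]) * g (quot G E)))]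
      have hR : ∀ E ∈ (fcs P).filter (fun E => F ⊆ E ∧ pdim E = a),
          (relFlag n I k E F : ℤ[X]) * g (quot P E) =
          ∑ G ∈ fcs P with E ⊆ G ∧ G ≠ P, gOp (D - a - 1) (pdim G - a - 1)
            ((relFlag n I k E F : ℤ[X]) * g (quot G E)) := by
        intro E hE
        simp only [Finset.mem_filter, mem_fcs hP] at hE
        have hne : E ≠ P := by
          rintro rfl; omega
        rw [gquot_rec hGH hP hE.1 hne, Finset.mul_sum]
        refine Finset.sum_congr rfl fun G _ => ?_
        rw [← nsmul_eq_mul, ← nsmul_eq_mul, map_nsmul, hPD, hE.2.2]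
      rw [Finset.sum_congr rfl hR]
      simp only [map_sum]
      apply Finset.sum_comm'
      intro G E
      constructor
      · rintro ⟨hG, hE⟩
        simp only [Finset.mem_filter, mem_fcs hP, Finset.mem_Ico] at hG
        have hGpoly := hG.1.isPolytope hP
        simp only [Finset.mem_filter, mem_fcs hGpoly] at hE
        simp only [Finset.mem_filter, mem_fcs hP]
        refine ⟨⟨hG.1, hE.1.subset, ?_⟩, hG.1.trans hP hE.1, hE.2⟩
        rintro rfl
        omega
      · rintro ⟨hG, hE⟩
        simp only [Finset.mem_filter, mem_fcs hP] at hG hE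
        have hGpoly := hG.1.isPolytope hP
        simp only [Finset.mem_filter, mem_fcs hP, mem_fcs hGpoly, Finset.mem_Ico]
        have h1 := pdim_lt hG.1 hG.2.2
        have h2 := pdim_mono hG.2.1
        exact ⟨⟨hG.1, hE.2.1.trans hG.2.1, by omega, by omega⟩,
          hE.1.restrict hG.1.subset hG.2.1, hE.2⟩

lemma claimB {g h : Set (Fin d → ℝ) → ℤ[X]} (hGH : IsGH g h) {e a D : ℤ} (haD : a ≤ D)
    {φ : Set (Fin d → ℝ) → Set (Fin d → ℝ) → ℤ[X]} (hφ : InV e a φ) :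
    InV e D (fun P F => ∑ E ∈ fcs P with (F ⊆ E ∧ pdim E = a), φ E F * g (quot P E)) := by
  induction hφ with
  | gen n I k c hI hb ht =>
    have h1 := claimB1 hGH e a n I k hI hb ht (D - a).toNat D (by omega)
    refine InV.congr _ _ ?_ (h1.map (AddMonoidHom.mulLeft c))
    intro P F _
    rw [AddMonoidHom.coe_mulLeft, Finset.mul_sum]
    exact Finset.sum_congr rfl fun E _ => (mul_assoc _ _ _).symm
  | zero => simpa using InV.zero
  | add φ φ' _ _ h1 h2 =>
    simp only [add_mul, Finset.sum_add_distrib]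
    exact InV.add _ _ h1 h2
  | congr φ φ' heq _ h =>
    refine InV.congr _ _ (fun P F hv => ?_) h
    refine Finset.sum_congr rfl fun G hG => ?_
    simp only [Finset.mem_filter, mem_fcs hv.1] at hG
    rw [heq G F ⟨hG.1.isPolytope hv.1, hG.2.2, hv.2.2.1.restrict hG.1.subset hG.2.1, hv.2.2.2⟩]

lemma relFlag_base : relFlag 1 (fun _ => -1) 0 (∅ : Set (Fin d → ℝ)) ∅ = 1 := by
  rw [relFlag, Set.ncard_eq_one]
  refine ⟨fun _ => ∅, ?_⟩
  ext c
  constructor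
  · rintro ⟨_, h, _⟩
    funext j
    exact pdim_eq_neg_one.1 (h j).2
  · rintro rfl
    exact ⟨Subsingleton.strictMono _, fun j => ⟨IsFace.refl _, pdim_empty⟩, subset_rfl⟩

lemma InV_g0 {g h : Set (Fin d → ℝ) → ℤ[X]} (hGH : IsGH g h) {D : ℤ} (hD : -1 ≤ D) :
    InV (-1) D (fun P (_ : Set (Fin d → ℝ)) => g P) := by
  have h1 := claimB1 hGH (-1) (-1) 1 (fun _ => -1) 0 (Subsingleton.strictMono _) (by simp)
    ⟨0, rfl⟩ (D + 1).toNat D (by omega)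
  refine InV.congr _ _ ?_ h1
  rintro P F ⟨hP, hPD, hF, he⟩
  obtain rfl := pdim_eq_neg_one.1 he
  rw [Finset.sum_eq_single ∅]
  · rw [relFlag_base, gquot_empty hGH hP]; simp
  · intro E hE hne
    simp only [Finset.mem_filter] at hE
    exact absurd (pdim_eq_neg_one.1 hE.2.2) hne
  · intro hcon
    refine absurd ?_ hcon
    simp only [Finset.mem_filter, mem_fcs hP]
    exact ⟨IsFace.empty P, subset_rfl, pdim_empty⟩

lemma InV.transfer {e D : ℤ} {φ : Set (Fin d → ℝ) → Set (Fin d → ℝ) → ℤ[X]}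
    (hφ : InV (-1) D φ) : InV e D (fun P _ => φ P ∅) := by
  induction hφ with
  | gen n I k c hI hb ht =>
    obtain ⟨j0, hj0⟩ := ht
    refine InV.congr _ _ ?_ (InV.gen n I j0 c hI hb ⟨j0, hj0⟩)
    rintro P F ⟨hP, hPD, hF, he⟩
    congr 2
    rw [relFlag, relFlag]
    congr 1
    ext c
    constructor
    · rintro ⟨h1, h2, _⟩
      exact ⟨h1, h2, Set.empty_subset _⟩
    · rintro ⟨h1, h2, _⟩
      refine ⟨h1, h2, ?_⟩
      rw [face_eq_of_pdim (h2 j0).1 (by rw [(h2 j0).2, hj0, hPD])]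
      exact hF.subset
  | zero => exact InV.zero
  | add φ φ' _ _ h1 h2 => exact InV.add _ _ h1 h2
  | congr φ φ' heq _ h =>
    refine InV.congr _ _ (fun P F hv => ?_) h
    exact heq P ∅ ⟨hv.1, hv.2.1, IsFace.empty P, pdim_empty⟩

lemma InV_gr {g h : Set (Fin d → ℝ) → ℤ[X]} (hGH : IsGH g h)
    {gr : Set (Fin d → ℝ) → Set (Fin d → ℝ) → ℤ[X]} (hgr : IsRelG g gr) (e : ℤ) (he : -1 ≤ e)
    (m : ℕ) : ∀ D : ℤ, D = e + m → InV e D gr := by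
  induction m using Nat.strong_induction_on with
  | _ m ih =>
    intro D hD
    have h1 : InV e D (fun P (_ : Set (Fin d → ℝ)) => g P) :=
      (InV_g0 hGH (by omega : -1 ≤ D)).transfer
    have h2 : InV e D (fun P F => ∑ D' ∈ Finset.Ico e D,
        ∑ E ∈ fcs P with (F ⊆ E ∧ pdim E = D'), gr E F * g (quot P E)) := by
      refine InV.sum (d := d) (Finset.Ico e D) _ fun D' hD' => ?_
      rw [Finset.mem_Ico] at hD'
      exact claimB hGH hD'.2.le (ih (D' - e).toNat (by omega) D' (by omega))
    refine InV.congr _ _ ?_ (h1.add _ _ (h2.map (AddMonoidHom.mulLeft (-1))))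
    rintro P F ⟨hP, hPD, hF, he'⟩
    rw [gr_rec hGH hgr hP hF, sum_by_dim (fcs P) F e D (fun _ E => gr E F * g (quot P E)),
      AddMonoidHom.coe_mulLeft, sub_eq_add_neg, neg_one_mul]
    congr 2
    refine Finset.sum_congr ?_ fun _ _ => rfl
    ext E
    simp only [Finset.mem_filter, mem_fcs hP, Finset.mem_Ico]
    constructor
    · rintro ⟨hE, hFE, _, hlt⟩
      refine ⟨hE, hFE, ?_⟩
      rintro rfl
      omega
    · rintro ⟨hE, hFE, hne⟩
      have := pdim_lt hE hne
      have := pdim_mono hFE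
      exact ⟨hE, hFE, by omega, by omega⟩

lemma InV.final {e D : ℤ} {φ : Set (Fin d → ℝ) → Set (Fin d → ℝ) → ℤ[X]} (hφ : InV e D φ) :
    ∃ c : ((n : ℕ) × ((Fin n → ℤ) × Fin n)) →₀ ℤ[X],
      (∀ p ∈ c.support, StrictMono p.2.1 ∧ ∀ j, -1 ≤ p.2.1 j ∧ p.2.1 j ≤ D) ∧
      ∀ P F, Valid e D P F →
        φ P F = c.sum fun p a => a * (relFlag p.1 p.2.1 p.2.2 P F : ℤ[X]) := by
  induction hφ with
  | gen n I k c hI hb ht =>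
    refine ⟨Finsupp.single ⟨n, I, k⟩ c, ?_, ?_⟩
    · intro p hp
      have := Finsupp.support_single_subset hp
      rw [Finset.mem_singleton] at this
      subst this
      exact ⟨hI, hb⟩
    · intro P F _
      rw [Finsupp.sum_single_index (by simp)]
  | zero => exact ⟨0, by simp, by simp⟩
  | add φ φ' _ _ h1 h2 =>
    obtain ⟨c, hc, h1⟩ := h1
    obtain ⟨c', hc', h2⟩ := h2
    refine ⟨c + c', ?_, ?_⟩
    · intro p hp
      rcases Finset.mem_union.1 (Finsupp.support_add hp) with h | h
      · exact hc p h
      · exact hc' p h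
    · intro P F hv
      rw [Finsupp.sum_add_index' (by simp) (by intros; ring), ← h1 P F hv, ← h2 P F hv]
  | congr φ φ' heq _ h =>
    obtain ⟨c, hc, h1⟩ := h
    exact ⟨c, hc, fun P F hv => by rw [← heq P F hv, h1 P F hv]⟩

end Flags

/-- For fixed `d`, `e`, `i`, the relative `g`-number `g_i(P,F)` of a
`d`-dimensional polytope `P` and a face `F` of dimension `e` is a fixed `ℤ`-linear
combination of the relative flag numbers `f_{I,k}(P,F)`. -/
theorem relative_g_linear_comb_of_flags {d : ℕ} (e : ℤ) (he₁ : -1 ≤ e) (he₂ : e ≤ (d : ℤ))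
    (i : ℕ) (g h : Set (Fin d → ℝ) → Polynomial ℤ)
    (gr : Set (Fin d → ℝ) → Set (Fin d → ℝ) → Polynomial ℤ)
    (hGH : IsGH g h) (hgr : IsRelG g gr) :
    ∃ c : ((n : ℕ) × ((Fin n → ℤ) × Fin n)) → ℤ,
      ∀ P F : Set (Fin d → ℝ), IsPolytope P → affineSpan ℝ P = ⊤ →
        IsFace P F → pdim F = e →
        (gr P F).coeff i =
          ∑ᶠ p ∈ {p : (n : ℕ) × ((Fin n → ℤ) × Fin n) |
              StrictMono p.2.1 ∧ (∀ j, -1 ≤ p.2.1 j ∧ p.2.1 j ≤ (d : ℤ)) ∧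
              e ≤ p.2.1 p.2.2},
            c p * (relFlag p.1 p.2.1 p.2.2 P F : ℤ) := by
  obtain ⟨c, hc, hsum⟩ := (InV_gr hGH hgr e he₁ ((d : ℤ) - e).toNat d (by omega)).final
  refine ⟨fun p => (c p).coeff i, ?_⟩
  intro P F hP hspan hF he
  have hne : P ≠ ∅ := by
    rintro rfl
    rw [AffineSubspace.span_empty] at hspan
    exact bot_ne_top hspan
  have hPd : pdim P = d := by
    rw [pdim, if_neg hne, hspan, AffineSubspace.direction_top, finrank_top]
    simp
  rw [hsum P F ⟨hP, hPd, hF, he⟩, Finsupp.sum, finsetSum_coeff,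
    finsum_mem_eq_sum_of_inter_support_eq (t := c.support)]
  · refine Finset.sum_congr rfl fun p _ => ?_
    rw [mul_comm, ← nsmul_eq_mul, coeff_smul, nsmul_eq_mul, mul_comm]
  · ext p
    simp only [Set.mem_inter_iff, Function.mem_support, Finset.mem_coe, Finsupp.mem_support_iff]
    constructor
    · rintro ⟨_, h2⟩
      refine ⟨fun h0 => h2 ?_, h2⟩
      simp [h0]
    · rintro ⟨h1, h2⟩
      obtain ⟨h3, h4⟩ := hc p (Finsupp.mem_support_iff.2 h1)
      refine ⟨⟨h3, h4, ?_⟩, h2⟩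
      have h5 : relFlag p.1 p.2.1 p.2.2 P F ≠ 0 := by
        intro h0
        rw [h0] at h2
        simp at h2
      obtain ⟨b, hb⟩ := Set.nonempty_of_ncard_ne_zero h5
      rw [← (hb.2.1 p.2.2).2, ← he]
      exact pdim_mono hb.2.2

end
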